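/- arXiv:1505.08044 — 3 statements merged into one kernel-verified Lean document; each statement's English description precedes it below -/
import Mathlib

section
/- For every integer k ≥ 1 and every p ∈ (0,1), the set H_{k,p} contains no infinite strictly increasing sequence; equivalently, every non-decreasing sequence of elements of H_{k,p} is eventually constant. -/
open Filter Topology

/-- A finite hypergraph with vertices in `ℕ`: a finite vertex set together with a
finite collection of hyperedges (finite sets of vertices). -/
structure FinHG where
  verts : Finset ℕ
  edges : Finset (Finset ℕ)

namespace FinHG

/-- A finite hypergraph is valid if every hyperedge is a nonempty subset of the vertex set. -/
def Valid (H : FinHG) : Prop :=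
  ∀ e ∈ H.edges, e.Nonempty ∧ e ⊆ H.verts

/-- `I` is an independent set of `H`: it contains no hyperedge. -/
def Indep (H : FinHG) (I : Finset ℕ) : Prop :=
  ∀ e ∈ H.edges, ¬ e ⊆ I

/-- The independence `p`-density of a finite hypergraph:
`∑_{I independent} p^|I| (1-p)^(|V| - |I|)`. -/
noncomputable def idp (H : FinHG) (p : ℝ) : ℝ :=
  ∑ I ∈ H.verts.powerset.filter fun I => ∀ e ∈ H.edges, ¬ e ⊆ I,
    p ^ I.card * (1 - p) ^ (H.verts.card - I.card)

/-- The rank of a finite hypergraph: the supremum of the sizes of its hyperedges. -/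
def rank (H : FinHG) : ℕ := H.edges.sup Finset.card

/-- The induced subhypergraph on a set `W` of vertices. -/
def induced (H : FinHG) (W : Finset ℕ) : FinHG :=
  ⟨W, H.edges.filter fun e => e ⊆ W⟩

end FinHG

/-- A countable hypergraph: the vertex set is a subset of `ℕ` and the hyperedges are
finite sets of vertices. -/
structure HG where
  verts : Set ℕ
  edges : Set (Finset ℕ)

namespace HG

/-- A countable hypergraph is valid if every hyperedge is a nonempty subset of the
vertex set. -/
def Valid (H : HG) : Prop :=
  ∀ e ∈ H.edges, e.Nonempty ∧ ↑e ⊆ H.verts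

/-- The rank of `H` is at most `k`: every hyperedge has size at most `k`. -/
def RankLe (H : HG) (k : ℕ) : Prop := ∀ e ∈ H.edges, e.card ≤ k

/-- The rank of `H` (the supremum of the sizes of hyperedges) equals `k`. -/
def RankEq (H : HG) (k : ℕ) : Prop := H.RankLe k ∧ ∃ e ∈ H.edges, e.card = k

/-- A chain for a countable hypergraph `H`: an increasing sequence of finite
hypergraphs, each an induced subhypergraph of the next, whose vertex sets and
hyperedge sets union to those of `H`. -/
def IsChain (H : HG) (C : ℕ → FinHG) : Prop :=
  (∀ n, ∀ e ∈ (C n).edges, e ⊆ (C n).verts) ∧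
  (∀ n, (C n).verts ⊆ (C (n + 1)).verts) ∧
  (∀ n, (C n).edges = (C (n + 1)).edges.filter fun e => e ⊆ (C n).verts) ∧
  (⋃ n, ((C n).verts : Set ℕ)) = H.verts ∧
  (⋃ n, ((C n).edges : Set (Finset ℕ))) = H.edges

/-- `x` is the independence `p`-density of the countable hypergraph `H`: along every
chain for `H`, the independence `p`-densities converge to `x`. -/
def idpLim (H : HG) (p x : ℝ) : Prop :=
  ∀ C : ℕ → FinHG, H.IsChain C → Tendsto (fun n => (C n).idp p) atTop (𝓝 x)

/-- The neighbourhood hypergraph of a set `A` of vertices: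
`N_H(A) = {F ⊆ V(H) \ A : F ∪ A ∈ H}`. -/
def nbhd (H : HG) (A : Finset ℕ) : Set (Finset ℕ) :=
  {F | ↑F ⊆ H.verts \ ↑A ∧ F ∪ A ∈ H.edges}

end HG

/-- `H_{k,p}`: the set of independence `p`-densities of countable hypergraphs of rank
at most `k`. -/
def HkSet (k : ℕ) (p : ℝ) : Set ℝ :=
  {x | ∃ H : HG, H.Valid ∧ H.RankLe k ∧ H.idpLim p x}

/-- A collection `E` of finite sets contains a matching (pairwise disjoint nonempty
members) of size at least `m`. -/
def HasMatching (E : Set (Finset ℕ)) (m : ℕ) : Prop :=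
  ∃ M : Finset (Finset ℕ), ↑M ⊆ E ∧ (∀ e ∈ M, e.Nonempty) ∧
    (M : Set (Finset ℕ)).Pairwise Disjoint ∧ m ≤ M.card

/-- A collection `E` of finite sets contains an infinite matching: an infinite
collection of pairwise disjoint nonempty members. -/
def HasInfMatching (E : Set (Finset ℕ)) : Prop :=
  ∃ Y : ℕ → Finset ℕ, (∀ i, Y i ∈ E) ∧ (∀ i, (Y i).Nonempty) ∧
    ∀ i j, i ≠ j → Disjoint (Y i) (Y j)

/-- The probability that a random subset of `V`, containing each vertex independently with
probability `p`, contains no member of `E`. -/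
noncomputable def indepProb (p : ℝ) (V : Finset ℕ) (E : Set (Finset ℕ)) : ℝ :=
  ∑ I ∈ V.powerset, p ^ I.card * (1 - p) ^ (V.card - I.card) *
    {J : Finset ℕ | ∀ e ∈ E, ¬ e ⊆ J}.indicator (fun _ => (1 : ℝ)) I

theorem indepProb_congr {p : ℝ} {V : Finset ℕ} {E F : Set (Finset ℕ)}
    (h : ∀ I ⊆ V, (∀ e ∈ E, ¬ e ⊆ I) ↔ ∀ e ∈ F, ¬ e ⊆ I) :
    indepProb p V E = indepProb p V F := by
  classical
  refine Finset.sum_congr rfl fun I hI => ?_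
  have := h I (Finset.mem_powerset.1 hI)
  simp only [Set.indicator_apply, Set.mem_ofPred_eq, this]

theorem indepProb_anti {p : ℝ} (hp0 : 0 < p) (hp1 : p < 1) (V : Finset ℕ)
    {E F : Set (Finset ℕ)} (h : ∀ I ⊆ V, (∀ e ∈ F, ¬ e ⊆ I) → ∀ e ∈ E, ¬ e ⊆ I) :
    indepProb p V F ≤ indepProb p V E := by
  classical
  refine Finset.sum_le_sum fun I hI => mul_le_mul_of_nonneg_left ?_ ?_
  · have := h I (Finset.mem_powerset.1 hI)
    simp only [Set.indicator_apply, Set.mem_ofPred_eq]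
    split_ifs <;> first | exact absurd (this ‹_›) ‹_› | norm_num
  · have := sub_pos.2 hp1
    positivity

theorem indepProb_nonneg {p : ℝ} (hp0 : 0 < p) (hp1 : p < 1) (V : Finset ℕ)
    (E : Set (Finset ℕ)) : 0 ≤ indepProb p V E := by
  refine Finset.sum_nonneg fun I _ => mul_nonneg ?_ (Set.indicator_nonneg (by simp) _)
  have := sub_pos.2 hp1
  positivity

theorem indepProb_of_empty_mem {p : ℝ} {V : Finset ℕ} {E : Set (Finset ℕ)} (h : ∅ ∈ E) :
    indepProb p V E = 0 := by
  refine Finset.sum_eq_zero fun I _ => ?_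
  rw [Set.indicator_of_notMem, mul_zero]
  exact fun hI => hI ∅ h (Finset.empty_subset _)

theorem indepProb_empty_edges (p : ℝ) (V : Finset ℕ) : indepProb p V ∅ = 1 := by
  simp [indepProb, Finset.sum_pow_mul_eq_add_pow]

theorem indepProb_insert (p : ℝ) {V : Finset ℕ} {v : ℕ} (hv : v ∉ V) (E : Set (Finset ℕ)) :
    indepProb p (insert v V) E =
      p * indepProb p V ((fun e => e.erase v) '' E) +
        (1 - p) * indepProb p V {e ∈ E | v ∉ e} := by
  classical
  have hdel : indepProb p V {e ∈ E | v ∉ e} = indepProb p V E :=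
    indepProb_congr fun I hI =>
      ⟨fun h e he hs => h e ⟨he, fun hve => hv (hI (hs hve))⟩ hs, fun h e he => h e he.1⟩
  rw [hdel]
  simp only [indepProb]
  rw [Finset.sum_powerset_insert hv, Finset.mul_sum, Finset.mul_sum, add_comm]
  congr 1
  · refine Finset.sum_congr rfl fun I hI => ?_
    have hI := Finset.mem_powerset.1 hI
    rw [Finset.card_insert_of_notMem hv, Finset.card_insert_of_notMem fun h => hv (hI h),
      Nat.add_sub_add_right, pow_succ]
    simp only [Set.indicator_apply, Set.mem_ofPred_eq, Set.forall_mem_image,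
      Finset.subset_insert_iff]
    ring
  · refine Finset.sum_congr rfl fun I hI => ?_
    have hI := Finset.card_le_card (Finset.mem_powerset.1 hI)
    rw [Finset.card_insert_of_notMem hv, Nat.succ_sub hI, pow_succ]
    ring

theorem indepProb_insert_of_forall_notMem (p : ℝ) (V : Finset ℕ) {v : ℕ}
    {E : Set (Finset ℕ)} (h : ∀ e ∈ E, v ∉ e) :
    indepProb p (insert v V) E = indepProb p V E := by
  by_cases hv : v ∈ V
  · rw [Finset.insert_eq_self.2 hv]
  have h1 : (fun e => e.erase v) '' E = E := by
    have : Set.EqOn (fun e => e.erase v) id E := fun e he => Finset.erase_eq_of_notMem (h e he)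
    rw [this.image_eq, Set.image_id]
  have h2 : {e ∈ E | v ∉ e} = E := Set.sep_eq_self_iff_mem_true.2 h
  rw [indepProb_insert p hv, h1, h2]
  ring

theorem indepProb_union_of_forall_disjoint (p : ℝ) (V D : Finset ℕ) {E : Set (Finset ℕ)}
    (h : ∀ e ∈ E, Disjoint e D) : indepProb p (D ∪ V) E = indepProb p V E := by
  induction D using Finset.induction_on with
  | empty => simp
  | insert v D _ ih =>
    simp only [Finset.disjoint_insert_right] at h
    rw [Finset.insert_union, indepProb_insert_of_forall_notMem p _ fun e he => (h e he).1,
      ih fun e he => (h e he).2]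

/-- Conditioning on a vertex `v` of `V`. -/
theorem indepProb_eq_condition (p : ℝ) {V : Finset ℕ} {v : ℕ} (hv : v ∈ V)
    (E : Set (Finset ℕ)) :
    indepProb p V E =
      p * indepProb p V ((fun e => e.erase v) '' E) +
        (1 - p) * indepProb p V {e ∈ E | v ∉ e} := by
  obtain ⟨W, hW, rfl⟩ : ∃ W, v ∉ W ∧ insert v W = V :=
    ⟨V.erase v, Finset.notMem_erase _ _, Finset.insert_erase hv⟩
  rw [indepProb_insert p hW, indepProb_insert_of_forall_notMem p W,
    indepProb_insert_of_forall_notMem p W]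
  · exact fun e he => he.2
  · rintro _ ⟨e, -, rfl⟩
    exact Finset.notMem_erase _ _

theorem indepProb_range_antitone {p : ℝ} (hp0 : 0 < p) (hp1 : p < 1) (E : Set (Finset ℕ)) :
    Antitone fun n => indepProb p (Finset.range n) E := by
  refine antitone_nat_of_succ_le fun n => ?_
  have hdel : indepProb p (Finset.range n) {e ∈ E | n ∉ e} = indepProb p (Finset.range n) E :=
    indepProb_congr fun I hI =>
      ⟨fun h e he hs => h e ⟨he, fun hve => by simpa using hI (hs hve)⟩ hs,
        fun h e he => h e he.1⟩
  have hle : indepProb p (Finset.range n) ((fun e => e.erase n) '' E) ≤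
      indepProb p (Finset.range n) E :=
    indepProb_anti hp0 hp1 _ fun I _ h e he hs =>
      h _ ⟨e, he, rfl⟩ ((Finset.erase_subset _ _).trans hs)
  rw [Finset.range_add_one, indepProb_insert p Finset.notMem_range_self, hdel]
  nlinarith

theorem exists_tendsto_indepProb {p : ℝ} (hp0 : 0 < p) (hp1 : p < 1) (E : Set (Finset ℕ)) :
    ∃ x, Tendsto (fun n => indepProb p (Finset.range n) E) atTop (𝓝 x) :=
  ⟨_, tendsto_atTop_ciInf (indepProb_range_antitone hp0 hp1 E)
    ⟨0, by rintro _ ⟨n, rfl⟩; exact indepProb_nonneg hp0 hp1 _ _⟩⟩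

theorem indepProb_insert_edge (p : ℝ) (e : Finset ℕ) :
    ∀ (V : Finset ℕ) (M : Set (Finset ℕ)), e ⊆ V → (∀ f ∈ M, Disjoint f e) →
      indepProb p V (insert e M) = (1 - p ^ e.card) * indepProb p V M := by
  induction e using Finset.induction_on with
  | empty =>
    intro V M _ _
    rw [indepProb_of_empty_mem (Set.mem_insert _ _)]
    simp
  | insert v e hve ih =>
    intro V M hV hM
    simp only [Finset.disjoint_insert_right] at hM
    rw [Finset.insert_subset_iff] at hV
    have h1 : (fun f => f.erase v) '' insert (insert v e) M = insert e M := by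
      have : Set.EqOn (fun f => f.erase v) id M :=
        fun f hf => Finset.erase_eq_of_notMem (hM f hf).1
      rw [Set.image_insert_eq, this.image_eq, Set.image_id, Finset.erase_insert hve]
    have h2 : {f ∈ insert (insert v e) M | v ∉ f} = M := by
      ext f
      constructor
      · rintro ⟨rfl | hf, hv⟩
        · exact absurd (Finset.mem_insert_self _ _) hv
        · exact hf
      · exact fun hf => ⟨Or.inr hf, (hM f hf).1⟩
    rw [indepProb_eq_condition p hV.1, h1, h2, ih V M hV.2 fun f hf => (hM f hf).2,
      Finset.card_insert_of_notMem hve]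
    ring

/-- Either the members of `E` have a small transversal or `E` is rarely avoided. -/
theorem exists_transversal_or_indepProb_le {p : ℝ} (hp0 : 0 < p) (hp1 : p < 1) {k : ℕ}
    {E : Set (Finset ℕ)} (hE : ∀ e ∈ E, e.card ≤ k) (m : ℕ) :
    ∃ T : Finset ℕ, T.card ≤ m * k ∧
      ((∀ e ∈ E, ¬ Disjoint e T) ∨
        ∃ M ⊆ E, (∀ e ∈ M, e ⊆ T) ∧ ∀ V, T ⊆ V → indepProb p V M ≤ (1 - p ^ k) ^ m) := by
  induction m with
  | zero =>
    exact ⟨∅, by simp, Or.inr ⟨∅, by simp, by simp, by simp [indepProb_empty_edges]⟩⟩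
  | succ m ih =>
    obtain ⟨T, hT, h | ⟨M, hME, hMT, hM⟩⟩ := ih
    · exact ⟨T, hT.trans (by gcongr; omega), Or.inl h⟩
    by_cases hc : ∀ e ∈ E, ¬ Disjoint e T
    · exact ⟨T, hT.trans (by gcongr; omega), Or.inl hc⟩
    push Not at hc
    obtain ⟨e, he, hd⟩ := hc
    refine ⟨e ∪ T, ?_, Or.inr ⟨insert e M, Set.insert_subset he hME, ?_, fun V hV => ?_⟩⟩
    · have := Finset.card_union_le e T
      have := hE e he
      rw [add_mul, one_mul]
      omega
    · rintro f (rfl | hf)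
      · exact Finset.subset_union_left
      · exact (hMT f hf).trans Finset.subset_union_right
    · obtain ⟨heV, hTV⟩ := Finset.union_subset_iff.1 hV
      rw [indepProb_insert_edge p e V M heV fun f hf =>
        (hd.mono_right (hMT f hf)).symm, pow_succ']
      have h1 : p ^ k ≤ p ^ e.card := pow_le_pow_of_le_one hp0.le hp1.le (hE e he)
      have h2 : p ^ k ≤ 1 := pow_le_one₀ hp0.le hp1.le
      exact mul_le_mul (by linarith) (hM V hTV) (indepProb_nonneg hp0 hp1 _ _) (by linarith)

/-- The limiting independence probabilities of families whose members have at most `k`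
elements outside some set of at most `t` vertices. -/
def densitySet (p : ℝ) (k t : ℕ) : Set ℝ :=
  {x | ∃ (E : Set (Finset ℕ)) (T : Finset ℕ), T.card ≤ t ∧ (∀ e ∈ E, (e \ T).card ≤ k) ∧
    Tendsto (fun n => indepProb p (Finset.range n) E) atTop (𝓝 x)}

theorem densitySet_succ_right_subset {p : ℝ} (hp0 : 0 < p) (hp1 : p < 1) (k t : ℕ) :
    densitySet p k (t + 1) ⊆
      (fun q : ℝ × ℝ => p * q.1 + (1 - p) * q.2) '' (densitySet p k t ×ˢ densitySet p k t) := by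
  rintro x ⟨E, T, hT, hE, hx⟩
  obtain ⟨v, T', hT', hTT'⟩ : ∃ (v : ℕ) (T' : Finset ℕ), T'.card ≤ t ∧ T ⊆ insert v T' := by
    rcases T.eq_empty_or_nonempty with rfl | ⟨v, hv⟩
    · exact ⟨0, ∅, by simp, by simp⟩
    · exact ⟨v, T.erase v, by rw [Finset.card_erase_of_mem hv]; omega,
        (Finset.insert_erase hv).ge⟩
  have hcard : ∀ e ∈ E, (e.erase v \ T').card ≤ k := by
    intro e he
    refine (Finset.card_le_card fun a ha => ?_).trans (hE e he)
    simp only [Finset.mem_sdiff, Finset.mem_erase] at ha ⊢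
    refine ⟨ha.1.2, fun haT => ?_⟩
    rcases Finset.mem_insert.1 (hTT' haT) with h | h
    · exact ha.1.1 h
    · exact ha.2 h
  obtain ⟨y, hy⟩ := exists_tendsto_indepProb hp0 hp1 ((fun e => e.erase v) '' E)
  obtain ⟨z, hz⟩ := exists_tendsto_indepProb hp0 hp1 {e ∈ E | v ∉ e}
  refine ⟨(y, z), ⟨⟨_, T', hT', ?_, hy⟩, ⟨_, T', hT', ?_, hz⟩⟩, ?_⟩
  · rintro _ ⟨e, he, rfl⟩
    exact hcard e he
  · intro e he
    have := hcard e he.1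
    rwa [Finset.erase_eq_of_notMem he.2] at this
  · refine tendsto_nhds_unique ((hy.const_mul p).add (hz.const_mul (1 - p))) (hx.congr' ?_)
    filter_upwards [eventually_gt_atTop v] with n hn
    exact indepProb_eq_condition p (Finset.mem_range.2 hn) E

theorem partiallyWellOrderedOn_densitySet_of_zero {p : ℝ} (hp0 : 0 < p) (hp1 : p < 1) {k : ℕ}
    (h : (densitySet p k 0).PartiallyWellOrderedOn (· ≥ ·)) (t : ℕ) :
    (densitySet p k t).PartiallyWellOrderedOn (· ≥ ·) := by
  induction t with
  | zero => exact h
  | succ t ih =>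
    refine Set.PartiallyWellOrderedOn.mono ?_ (densitySet_succ_right_subset hp0 hp1 k t)
    refine (ih.prod ih).image_of_monotone_on fun a _ b _ hab => ?_
    have := sub_pos.2 hp1
    have h1 : b.1 ≤ a.1 := hab.1
    have h2 : b.2 ≤ a.2 := hab.2
    change p * b.1 + (1 - p) * b.2 ≤ p * a.1 + (1 - p) * a.2
    gcongr

theorem densitySet_zero_zero_subset (p : ℝ) : densitySet p 0 0 ⊆ {0, 1} := by
  rintro x ⟨E, T, hT, hE, hx⟩
  have hE0 : ∀ e ∈ E, e = ∅ := by
    obtain rfl : T = ∅ := by simpa using hT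
    simpa using hE
  rcases E.eq_empty_or_nonempty with rfl | ⟨e, he⟩
  · simp only [indepProb_empty_edges] at hx
    exact Or.inr (tendsto_nhds_unique hx tendsto_const_nhds)
  · have : ∅ ∈ E := hE0 e he ▸ he
    simp only [indepProb_of_empty_mem this] at hx
    exact Or.inl (tendsto_nhds_unique hx tendsto_const_nhds)

theorem exists_mem_densitySet_of_le {p : ℝ} (hp0 : 0 < p) (hp1 : p < 1) (k : ℕ) {ε : ℝ}
    (hε : 0 < ε) : ∃ t, ∀ x ∈ densitySet p (k + 1) 0, ε ≤ x → x ∈ densitySet p k t := by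
  have hpk : 0 < p ^ (k + 1) := by positivity
  have hpk1 : p ^ (k + 1) ≤ 1 := pow_le_one₀ hp0.le hp1.le
  obtain ⟨m, hm⟩ := exists_pow_lt_of_lt_one hε (by linarith : 1 - p ^ (k + 1) < 1)
  refine ⟨m * (k + 1), ?_⟩
  rintro x ⟨E, T₀, hT₀, hE, hx⟩ hεx
  obtain rfl : T₀ = ∅ := by simpa using hT₀
  simp only [Finset.sdiff_empty] at hE
  obtain ⟨T, hT, h | ⟨M, hME, -, hM⟩⟩ := exists_transversal_or_indepProb_le hp0 hp1 hE m
  · refine ⟨E, T, hT, fun e he => ?_, hx⟩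
    have h1 := Finset.card_sdiff_add_card_inter e T
    have h2 : 0 < (e ∩ T).card :=
      Finset.card_pos.2 (Finset.not_disjoint_iff_nonempty_inter.1 (h e he))
    have := hE e he
    omega
  · have hle : x ≤ (1 - p ^ (k + 1)) ^ m := by
      refine le_of_tendsto hx ?_
      filter_upwards [eventually_gt_atTop (T.sup id)] with n hn
      refine (indepProb_anti hp0 hp1 _ fun I _ h e he => h e (hME he)).trans (hM _ fun v hv => ?_)
      exact Finset.mem_range.2 ((Finset.le_sup (f := id) hv).trans_lt hn)
    linarith

theorem nonneg_of_mem_densitySet {p : ℝ} (hp0 : 0 < p) (hp1 : p < 1) {k t : ℕ} {x : ℝ}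
    (hx : x ∈ densitySet p k t) : 0 ≤ x := by
  obtain ⟨E, T, -, -, hx⟩ := hx
  exact ge_of_tendsto' hx fun n => indepProb_nonneg hp0 hp1 _ _

theorem partiallyWellOrderedOn_densitySet {p : ℝ} (hp0 : 0 < p) (hp1 : p < 1) (k : ℕ) :
    (densitySet p k 0).PartiallyWellOrderedOn (· ≥ ·) := by
  induction k with
  | zero =>
    exact (Set.Finite.partiallyWellOrderedOn (by simp)).mono (densitySet_zero_zero_subset p)
  | succ k ih =>
    rw [Set.partiallyWellOrderedOn_iff_exists_lt]
    intro f hf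
    by_contra! hmono
    have hpos : 0 < f 1 :=
      (nonneg_of_mem_densitySet hp0 hp1 (hf 0)).trans_lt (hmono 0 1 one_pos)
    obtain ⟨t, ht⟩ := exists_mem_densitySet_of_le hp0 hp1 k hpos
    have hmem : ∀ n, f (n + 1) ∈ densitySet p k t := by
      intro n
      refine ht _ (hf _) ?_
      rcases n.eq_zero_or_pos with rfl | hn
      · exact le_rfl
      · exact (hmono 1 (n + 1) (by omega)).le
    obtain ⟨m, n, hmn, hge⟩ :=
      (partiallyWellOrderedOn_densitySet_of_zero hp0 hp1 ih t).exists_lt hmem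
    exact absurd (hmono (m + 1) (n + 1) (by omega)) (not_lt.2 hge)

theorem FinHG.idp_eq_indepProb (C : FinHG) (p : ℝ) :
    C.idp p = indepProb p C.verts (C.edges : Set (Finset ℕ)) := by
  classical
  simp only [FinHG.idp, indepProb, Finset.sum_filter]
  refine Finset.sum_congr rfl fun I _ => ?_
  simp [Set.indicator_apply]

open Classical in
/-- The chain of subhypergraphs of `H` induced on the initial segments of `ℕ`. -/
noncomputable def HG.initialSegment (H : HG) (n : ℕ) : FinHG where
  verts := {v ∈ Finset.range n | v ∈ H.verts}
  edges := {e ∈ ({v ∈ Finset.range n | v ∈ H.verts} : Finset ℕ).powerset | e ∈ H.edges}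

theorem HG.mem_verts_initialSegment {H : HG} {n v : ℕ} :
    v ∈ (H.initialSegment n).verts ↔ v < n ∧ v ∈ H.verts := by
  simp [HG.initialSegment]

theorem HG.mem_edges_initialSegment {H : HG} {n : ℕ} {e : Finset ℕ} :
    e ∈ (H.initialSegment n).edges ↔ e ⊆ (H.initialSegment n).verts ∧ e ∈ H.edges := by
  simp [HG.initialSegment]

theorem HG.isChain_initialSegment {H : HG} (hH : H.Valid) : H.IsChain H.initialSegment := by
  have hsucc : ∀ n, (H.initialSegment n).verts ⊆ (H.initialSegment (n + 1)).verts := by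
    intro n v
    simp only [HG.mem_verts_initialSegment]
    exact fun h => ⟨by omega, h.2⟩
  refine ⟨fun n e he => (HG.mem_edges_initialSegment.1 he).1, hsucc, fun n => ?_, ?_, ?_⟩
  · ext e
    simp only [Finset.mem_filter, HG.mem_edges_initialSegment]
    exact ⟨fun h => ⟨⟨h.1.trans (hsucc n), h.2⟩, h.1⟩, fun h => ⟨h.2, h.1.2⟩⟩
  · ext v
    simp only [Set.mem_iUnion, Finset.mem_coe, HG.mem_verts_initialSegment]
    exact ⟨fun ⟨_, h⟩ => h.2, fun h => ⟨v + 1, by omega, h⟩⟩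
  · ext e
    simp only [Set.mem_iUnion, Finset.mem_coe, HG.mem_edges_initialSegment]
    refine ⟨fun ⟨_, h⟩ => h.2, fun h => ⟨e.sup id + 1, fun v hv => ?_, h⟩⟩
    have : v ≤ e.sup id := Finset.le_sup (f := id) hv
    exact HG.mem_verts_initialSegment.2 ⟨by omega, (hH e h).2 hv⟩

theorem HG.idp_initialSegment {H : HG} (hH : H.Valid) (p : ℝ) (n : ℕ) :
    (H.initialSegment n).idp p = indepProb p (Finset.range n) H.edges := by
  have hsub : (H.initialSegment n).verts ⊆ Finset.range n := fun v hv =>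
    Finset.mem_range.2 (HG.mem_verts_initialSegment.1 hv).1
  rw [FinHG.idp_eq_indepProb, ← Finset.sdiff_union_of_subset hsub,
    indepProb_union_of_forall_disjoint]
  · refine indepProb_congr fun I hI => ⟨fun h e he hs => ?_, fun h e he => ?_⟩
    · exact h e (HG.mem_edges_initialSegment.2 ⟨hs.trans hI, he⟩) hs
    · exact h e (HG.mem_edges_initialSegment.1 he).2
  · intro e he
    rw [Finset.disjoint_left]
    intro v hv hvn
    rw [Finset.mem_sdiff, Finset.mem_range] at hvn
    exact hvn.2 (HG.mem_verts_initialSegment.2 ⟨hvn.1, (hH e he).2 hv⟩)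

theorem HkSet_subset_densitySet (k : ℕ) (p : ℝ) : HkSet k p ⊆ densitySet p k 0 := by
  rintro x ⟨H, hH, hk, hx⟩
  refine ⟨H.edges, ∅, by simp, by simpa [HG.RankLe] using hk, ?_⟩
  simpa only [HG.idp_initialSegment hH] using hx _ (HG.isChain_initialSegment hH)

/-- `H_{k,p}` contains no infinite strictly increasing sequence; equivalently, every
non-decreasing sequence of elements of `H_{k,p}` is eventually constant. -/
theorem stmt_3 (k : ℕ) (hk : 1 ≤ k) (p : ℝ) (hp0 : 0 < p) (hp1 : p < 1) :
    (¬ ∃ f : ℕ → ℝ, (∀ n, f n ∈ HkSet k p) ∧ StrictMono f) ∧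
      ∀ f : ℕ → ℝ, (∀ n, f n ∈ HkSet k p) → Monotone f →
        ∃ N : ℕ, ∀ n, N ≤ n → f n = f N := by
  have hpwo : (HkSet k p).PartiallyWellOrderedOn (· ≥ ·) :=
    (partiallyWellOrderedOn_densitySet hp0 hp1 k).mono (HkSet_subset_densitySet k p)
  refine ⟨?_, fun f hf hmono => ?_⟩
  · rintro ⟨f, hf, hmono⟩
    obtain ⟨m, n, hmn, hge⟩ := hpwo.exists_lt hf
    exact absurd (hmono hmn) (not_lt.2 hge)
  · by_contra! hne
    choose g hg hgne using hne
    have hlt : ∀ N, f N < f (g N) := fun N => (hmono (hg N)).lt_of_ne (hgne N).symm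
    have hstrict : StrictMono fun i => f (g^[i] 0) := strictMono_nat_of_lt_succ fun i => by
      rw [Function.iterate_succ_apply']
      exact hlt _
    obtain ⟨m, n, hmn, hge⟩ := hpwo.exists_lt fun i => hf (g^[i] 0)
    exact absurd (hstrict hmn) (not_lt.2 hge)
end

section
/- Let G be a graph on a countable vertex set with id(G) > 0, where id(G) = id_{1/2}(G). Then there exists a finite graph H with id(H) = id(G). -/
open Filter Topology

open Classical in
/-- The independent subsets of `W` with respect to the hyperedge collection `E`. -/
noncomputable def indepSets (E : Set (Finset ℕ)) (W : Finset ℕ) : Finset (Finset ℕ) :=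
  W.powerset.filter fun I => ∀ e ∈ E, ¬ e ⊆ I

/-- The proportion of subsets of `W` that are independent. -/
noncomputable def indepDensity (E : Set (Finset ℕ)) (W : Finset ℕ) : ℝ :=
  (indepSets E W).card / 2 ^ W.card

theorem mem_indepSets {E : Set (Finset ℕ)} {W I : Finset ℕ} :
    I ∈ indepSets E W ↔ I ⊆ W ∧ ∀ e ∈ E, ¬ e ⊆ I := by
  simp [indepSets]

theorem FinHG.idp_half (H : FinHG) :
    H.idp (1 / 2) = indepDensity (H.edges : Set (Finset ℕ)) H.verts := by
  have h : ∀ I ∈ H.verts.powerset.filter (fun I => ∀ e ∈ H.edges, ¬ e ⊆ I),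
      (1 / 2 : ℝ) ^ I.card * (1 - 1 / 2) ^ (H.verts.card - I.card) = 1 / 2 ^ H.verts.card := by
    intro I hI
    have hc := Finset.card_le_card (Finset.mem_powerset.1 (Finset.mem_filter.1 hI).1)
    rw [show (1 - 1 / 2 : ℝ) = 1 / 2 by norm_num, ← pow_add, Nat.add_sub_cancel' hc, one_div_pow]
  rw [FinHG.idp, Finset.sum_congr rfl h, Finset.sum_const, nsmul_eq_mul, indepDensity,
    mul_one_div]
  congr 3
  ext I
  simp [mem_indepSets]

theorem indepSets_congr {E F : Set (Finset ℕ)} {W : Finset ℕ}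
    (h : ∀ e ⊆ W, (e ∈ E ↔ e ∈ F)) : indepSets E W = indepSets F W := by
  ext I
  simp only [mem_indepSets]
  refine and_congr_right fun hI => ?_
  exact ⟨fun H e he hs => H e ((h e (hs.trans hI)).2 he) hs,
    fun H e he hs => H e ((h e (hs.trans hI)).1 he) hs⟩

theorem indepDensity_congr {E F : Set (Finset ℕ)} {W : Finset ℕ}
    (h : ∀ e ⊆ W, (e ∈ E ↔ e ∈ F)) : indepDensity E W = indepDensity F W := by
  rw [indepDensity, indepDensity, indepSets_congr h]

theorem card_indepSets_union_le (E : Set (Finset ℕ)) (U W : Finset ℕ) :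
    (indepSets E (U ∪ W)).card ≤ (indepSets E U).card * (indepSets E W).card := by
  rw [← Finset.card_product]
  refine Finset.card_le_card_of_injOn (fun I => (I ∩ U, I ∩ W)) ?_ ?_
  · intro I hI
    have hI := mem_indepSets.1 (Finset.mem_coe.1 hI)
    simp only [Finset.coe_product, Set.mem_prod, Finset.mem_coe, mem_indepSets]
    exact ⟨⟨Finset.inter_subset_right,
      fun e he hs => hI.2 e he (hs.trans Finset.inter_subset_left)⟩,
      ⟨Finset.inter_subset_right, fun e he hs => hI.2 e he (hs.trans Finset.inter_subset_left)⟩⟩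
  · intro I hI J hJ hIJ
    have hI := (mem_indepSets.1 (Finset.mem_coe.1 hI)).1
    have hJ := (mem_indepSets.1 (Finset.mem_coe.1 hJ)).1
    simp only [Prod.mk.injEq] at hIJ
    rw [← Finset.inter_eq_left.2 hI, ← Finset.inter_eq_left.2 hJ, Finset.inter_union_distrib_left,
      Finset.inter_union_distrib_left, hIJ.1, hIJ.2]

theorem card_indepSets_union {E : Set (Finset ℕ)} {U W : Finset ℕ} (hd : Disjoint U W)
    (h : ∀ e ∈ E, e ⊆ U ∪ W → e ⊆ U ∨ e ⊆ W) :
    (indepSets E (U ∪ W)).card = (indepSets E U).card * (indepSets E W).card := by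
  refine (card_indepSets_union_le E U W).antisymm ?_
  rw [← Finset.card_product]
  have key : ∀ I J : Finset ℕ, I ⊆ U → J ⊆ W → (I ∪ J) ∩ U = I ∧ (I ∪ J) ∩ W = J := by
    intro I J hI hJ
    constructor
    · rw [Finset.union_inter_distrib_right, Finset.inter_eq_left.2 hI,
        Finset.disjoint_iff_inter_eq_empty.1 (hd.symm.mono_left hJ), Finset.union_empty]
    · rw [Finset.union_inter_distrib_right, Finset.inter_eq_left.2 hJ,
        Finset.disjoint_iff_inter_eq_empty.1 (hd.mono_left hI), Finset.empty_union]
  refine Finset.card_le_card_of_injOn (fun p => p.1 ∪ p.2) ?_ ?_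
  · rintro ⟨I, J⟩ hp
    simp only [Finset.coe_product, Set.mem_prod, Finset.mem_coe, mem_indepSets] at hp ⊢
    obtain ⟨⟨hI, hIi⟩, hJ, hJi⟩ := hp
    refine ⟨Finset.union_subset_union hI hJ, fun e he hs => ?_⟩
    obtain ⟨k₁, k₂⟩ := key I J hI hJ
    rcases h e he (hs.trans (Finset.union_subset_union hI hJ)) with hU | hW
    · exact hIi e he (k₁ ▸ Finset.subset_inter hs hU)
    · exact hJi e he (k₂ ▸ Finset.subset_inter hs hW)
  · rintro ⟨I, J⟩ hp ⟨I', J'⟩ hp' heq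
    simp only [Finset.coe_product, Set.mem_prod, Finset.mem_coe, mem_indepSets] at hp hp' heq
    obtain ⟨k₁, k₂⟩ := key I J hp.1.1 hp.2.1
    obtain ⟨k₁', k₂'⟩ := key I' J' hp'.1.1 hp'.2.1
    rw [Prod.mk.injEq]
    exact ⟨by rw [← k₁, heq, k₁'], by rw [← k₂, heq, k₂']⟩

theorem indepDensity_nonneg (E : Set (Finset ℕ)) (W : Finset ℕ) : 0 ≤ indepDensity E W := by
  unfold indepDensity; positivity

theorem indepDensity_le_one (E : Set (Finset ℕ)) (W : Finset ℕ) : indepDensity E W ≤ 1 := by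
  unfold indepDensity
  rw [div_le_one (by positivity)]
  have h : (indepSets E W).card ≤ 2 ^ W.card := by
    rw [← Finset.card_powerset]
    exact Finset.card_le_card fun I hI => Finset.mem_powerset.2 (mem_indepSets.1 hI).1
  exact_mod_cast h

theorem indepDensity_union_le {E : Set (Finset ℕ)} {U W : Finset ℕ} (hd : Disjoint U W) :
    indepDensity E (U ∪ W) ≤ indepDensity E U * indepDensity E W := by
  unfold indepDensity
  rw [Finset.card_union_of_disjoint hd, pow_add, div_mul_div_comm]
  gcongr
  exact_mod_cast card_indepSets_union_le E U W

theorem indepDensity_union {E : Set (Finset ℕ)} {U W : Finset ℕ} (hd : Disjoint U W)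
    (h : ∀ e ∈ E, e ⊆ U ∪ W → e ⊆ U ∨ e ⊆ W) :
    indepDensity E (U ∪ W) = indepDensity E U * indepDensity E W := by
  unfold indepDensity
  rw [Finset.card_union_of_disjoint hd, pow_add, div_mul_div_comm, card_indepSets_union hd h,
    Nat.cast_mul]

theorem indepDensity_anti (E : Set (Finset ℕ)) : Antitone (indepDensity E) := by
  intro U W h
  rw [← Finset.union_sdiff_of_subset h]
  exact (indepDensity_union_le Finset.disjoint_sdiff).trans
    (mul_le_of_le_one_right (indepDensity_nonneg _ _) (indepDensity_le_one _ _))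

theorem indepDensity_eq_one {E : Set (Finset ℕ)} {W : Finset ℕ} (h : ∀ e ∈ E, ¬ e ⊆ W) :
    indepDensity E W = 1 := by
  have : indepSets E W = W.powerset := by
    ext I
    simp only [mem_indepSets, Finset.mem_powerset, and_iff_left_iff_imp]
    exact fun hI e he hs => h e he (hs.trans hI)
  rw [indepDensity, this, Finset.card_powerset, Nat.cast_pow, Nat.cast_ofNat,
    div_self (by positivity)]

theorem indepDensity_edge_le {E : Set (Finset ℕ)} {e : Finset ℕ} (he : e ∈ E) (hc : e.card = 2) :
    indepDensity E e ≤ 3 / 4 := by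
  have h : (indepSets E e).card ≤ 3 := by
    have : (e.ssubsets).card = 3 := by
      rw [Finset.ssubsets, Finset.card_erase_of_mem (Finset.mem_powerset_self e),
        Finset.card_powerset, hc]; norm_num
    rw [← this]
    refine Finset.card_le_card fun I hI => ?_
    have hI := mem_indepSets.1 hI
    exact Finset.mem_ssubsets.2 ⟨hI.1, hI.2 e he⟩
  have h' : ((indepSets E e).card : ℝ) ≤ 3 := by exact_mod_cast h
  rw [indepDensity, hc]
  linarith

theorem indepDensity_triangle {T : Finset ℕ} (hT : T.card = 3) :
    indepDensity (T.powersetCard 2 : Set (Finset ℕ)) T = 1 / 2 := by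
  have h : indepSets (T.powersetCard 2 : Set (Finset ℕ)) T =
      T.powersetCard 0 ∪ T.powersetCard 1 := by
    ext I
    simp only [mem_indepSets, Finset.mem_coe, Finset.mem_union, Finset.mem_powersetCard]
    constructor
    · rintro ⟨hI, h⟩
      have : I.card < 2 := by
        by_contra! hc
        obtain ⟨e, heI, he⟩ := Finset.exists_subset_card_eq hc
        exact h e ⟨heI.trans hI, he⟩ heI
      rcases (show I.card = 0 ∨ I.card = 1 by omega) with h | h
      · exact Or.inl ⟨hI, h⟩
      · exact Or.inr ⟨hI, h⟩
    · intro h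
      refine ⟨h.elim And.left And.left, fun e he hs => ?_⟩
      have := Finset.card_le_card hs
      omega
  rw [indepDensity, h, Finset.card_union_of_disjoint, Finset.card_powersetCard,
    Finset.card_powersetCard, hT]
  · norm_num
  · exact Finset.pairwise_disjoint_powersetCard T (by norm_num : (0 : ℕ) ≠ 1)

/-- Adjoining a disjoint triangle halves the independence density. -/
theorem FinHG.exists_idp_half_div_two (H : FinHG) (hv : H.Valid)
    (hg : ∀ e ∈ H.edges, e.card = 2) :
    ∃ K : FinHG, K.Valid ∧ (∀ e ∈ K.edges, e.card = 2) ∧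
      K.idp (1 / 2) = H.idp (1 / 2) / 2 := by
  obtain ⟨T, hTd, hT⟩ : ∃ T : Finset ℕ, Disjoint H.verts T ∧ T.card = 3 := by
    obtain ⟨T, hTs, hT⟩ :=
      (Set.Finite.infinite_compl H.verts.finite_toSet).exists_subset_card_eq 3
    exact ⟨T, Finset.disjoint_right.2 fun a ha => by simpa using hTs ha, hT⟩
  have hsep : ∀ e, e.card = 2 → e ⊆ H.verts → ¬ e ⊆ T := by
    intro e he h₁ h₂
    have := Finset.subset_empty.1 (hTd h₁ h₂)
    simp [this] at he
  refine ⟨⟨H.verts ∪ T, H.edges ∪ T.powersetCard 2⟩, ?_, ?_, ?_⟩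
  · intro e he
    rcases Finset.mem_union.1 he with he | he
    · exact ⟨(hv e he).1, (hv e he).2.trans Finset.subset_union_left⟩
    · obtain ⟨hs, hc⟩ := Finset.mem_powersetCard.1 he
      exact ⟨Finset.card_pos.1 (by omega), hs.trans Finset.subset_union_right⟩
  · intro e he
    rcases Finset.mem_union.1 he with he | he
    · exact hg e he
    · exact (Finset.mem_powersetCard.1 he).2
  · rw [idp_half, idp_half, indepDensity_union hTd]
    · rw [div_eq_mul_one_div, ← indepDensity_triangle hT]
      congr 1
      · refine indepDensity_congr fun e he => ?_
        simp only [Finset.mem_coe, Finset.mem_union, Finset.mem_powersetCard, or_iff_left_iff_imp]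
        exact fun h => (hsep e h.2 he h.1).elim
      · refine indepDensity_congr fun e he => ?_
        simp only [Finset.mem_coe, Finset.mem_union, or_iff_right_iff_imp]
        exact fun h => (hsep e (hg e h) (hv e h).2 he).elim
    · intro e he _
      rcases Finset.mem_union.1 (Finset.mem_coe.1 he) with he | he
      · exact Or.inl (hv e he).2
      · exact Or.inr (Finset.mem_powersetCard.1 he).1

theorem FinHG.exists_idp_half_div_two_pow (H : FinHG) (hv : H.Valid)
    (hg : ∀ e ∈ H.edges, e.card = 2) (k : ℕ) :
    ∃ K : FinHG, K.Valid ∧ (∀ e ∈ K.edges, e.card = 2) ∧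
      K.idp (1 / 2) = H.idp (1 / 2) / 2 ^ k := by
  induction k with
  | zero => exact ⟨H, hv, hg, by simp⟩
  | succ k ih =>
    obtain ⟨K, hKv, hKg, hK⟩ := ih
    obtain ⟨L, hLv, hLg, hL⟩ := K.exists_idp_half_div_two hKv hKg
    exact ⟨L, hLv, hLg, by rw [hL, hK, div_div, pow_succ]⟩

/-- A countable hypergraph is exhausted by finite vertex sets along which the densities of
independent sets converge to its independence density. -/
theorem HG.Valid.exists_exhaustion {G : HG} (hG : G.Valid) {x : ℝ} (hx : G.idpLim (1 / 2) x) :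
    ∃ W : ℕ → Finset ℕ, (∀ F : Finset ℕ, (F : Set ℕ) ⊆ G.verts → ∀ᶠ n in atTop, F ⊆ W n) ∧
      Tendsto (fun n => indepDensity G.edges (W n)) atTop (𝓝 x) := by
  classical
  let W : ℕ → Finset ℕ := fun n => (Finset.range n).filter (· ∈ G.verts)
  have hmono : Monotone W := fun m n hmn =>
    Finset.filter_subset_filter _ (Finset.range_mono hmn)
  have hW : ∀ F : Finset ℕ, (F : Set ℕ) ⊆ G.verts → ∀ᶠ n in atTop, F ⊆ W n := by
    intro F hF
    filter_upwards [eventually_gt_atTop (F.sup id)] with n hn v hv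
    exact Finset.mem_filter.2
      ⟨Finset.mem_range.2 ((Finset.le_sup (f := id) hv).trans_lt hn), hF hv⟩
  have hchain : G.IsChain fun n => ⟨W n, (W n).powerset.filter (· ∈ G.edges)⟩ := by
    refine ⟨fun n e he => ?_, fun n => hmono n.le_succ, fun n => ?_, ?_, ?_⟩
    · exact Finset.mem_powerset.1 (Finset.mem_filter.1 he).1
    · ext e
      simp only [Finset.mem_filter, Finset.mem_powerset]
      exact ⟨fun h => ⟨⟨h.1.trans (hmono n.le_succ), h.2⟩, h.1⟩, fun h => ⟨h.2, h.1.2⟩⟩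
    · ext v
      simp only [Set.mem_iUnion, Finset.mem_coe]
      refine ⟨fun ⟨n, hn⟩ => (Finset.mem_filter.1 hn).2, fun hv => ?_⟩
      obtain ⟨n, hn⟩ := (hW {v} (by simpa using hv)).exists
      exact ⟨n, hn (Finset.mem_singleton_self v)⟩
    · ext e
      simp only [Set.mem_iUnion, Finset.mem_coe, Finset.mem_filter, Finset.mem_powerset]
      refine ⟨fun ⟨n, hn⟩ => hn.2, fun he => ?_⟩
      obtain ⟨n, hn⟩ := (hW e (hG e he).2).exists
      exact ⟨n, hn, he⟩
  refine ⟨W, hW, (hx _ hchain).congr fun n => ?_⟩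
  rw [FinHG.idp_half]
  exact indepDensity_congr fun e he => by simp [he]

/-- If no finite set of vertices meets every edge, there are finite vertex sets of
arbitrarily small independence density. -/
theorem HG.exists_indepDensity_le_pow {G : HG} (hG : G.Valid) (hg : ∀ e ∈ G.edges, e.card = 2)
    (h : ∀ S : Finset ℕ, ∃ e ∈ G.edges, Disjoint S e) (m : ℕ) :
    ∃ F : Finset ℕ, (F : Set ℕ) ⊆ G.verts ∧ indepDensity G.edges F ≤ (3 / 4) ^ m := by
  induction m with
  | zero => exact ⟨∅, by simp, by simpa using indepDensity_le_one _ _⟩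
  | succ m ih =>
    obtain ⟨F, hF, hFd⟩ := ih
    obtain ⟨e, he, hd⟩ := h F
    refine ⟨F ∪ e, by simpa using ⟨hF, (hG e he).2⟩, ?_⟩
    rw [pow_succ]
    exact (indepDensity_union_le hd).trans
      (mul_le_mul hFd (indepDensity_edge_le he (hg e he)) (indepDensity_nonneg _ _) (by positivity))

/-- A graph with positive independence density has a finite vertex cover. -/
theorem HG.exists_finite_vertexCover {G : HG} (hG : G.Valid) (hg : ∀ e ∈ G.edges, e.card = 2)
    {x : ℝ} (hx : G.idpLim (1 / 2) x) (hpos : 0 < x) :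
    ∃ S : Finset ℕ, ∀ e ∈ G.edges, ¬ Disjoint S e := by
  by_contra! h
  obtain ⟨W, hW, hlim⟩ := hG.exists_exhaustion hx
  refine hpos.not_ge (ge_of_tendsto' (tendsto_pow_atTop_nhds_zero_of_lt_one
    (by norm_num : (0 : ℝ) ≤ 3 / 4) (by norm_num)) fun m => ?_)
  obtain ⟨F, hF, hFd⟩ := exists_indepDensity_le_pow hG hg h m
  exact le_of_tendsto hlim ((hW F hF).mono fun n hn => (indepDensity_anti _ hn).trans hFd)

theorem HG.exists_neighbors {G : HG} (hG : G.Valid) (hg : ∀ e ∈ G.edges, e.card = 2) {a : ℕ}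
    (ha : {e ∈ G.edges | a ∈ e}.Infinite) (k : ℕ) :
    ∃ N : Finset ℕ, (N : Set ℕ) ⊆ G.verts ∧ N.card = k ∧ ∀ v ∈ N, {a, v} ∈ G.edges := by
  have hinf : {v | {a, v} ∈ G.edges}.Infinite := by
    intro hfin
    refine ha ((hfin.image fun v => ({a, v} : Finset ℕ)).subset ?_)
    rintro e ⟨he, hae⟩
    obtain ⟨u, v, -, rfl⟩ := Finset.card_eq_two.1 (hg e he)
    rcases Finset.mem_insert.1 hae with rfl | h
    · exact ⟨v, he, rfl⟩
    · obtain rfl := Finset.mem_singleton.1 h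
      rw [Finset.pair_comm] at he ⊢
      exact ⟨u, he, rfl⟩
  obtain ⟨N, hN, hc⟩ := hinf.exists_subset_card_eq k
  exact ⟨N, fun v hv => (hG _ (hN hv)).2 (by simp), hc, hN⟩

/-- If every edge not meeting `A` lies inside `U`, then the independence density of `W \ A`
is that of `U`. -/
theorem indepDensity_sdiff {E : Set (Finset ℕ)} (hE : ∀ e ∈ E, e.Nonempty) {A U W : Finset ℕ}
    (hAU : Disjoint A U) (hU : U ⊆ W) (h : ∀ e ∈ E, Disjoint A e → e ⊆ U) :
    indepDensity E (W \ A) = indepDensity E U := by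
  have hUW : U ⊆ W \ A := Finset.subset_sdiff.2 ⟨hU, hAU.symm⟩
  have hsub : ∀ e ∈ E, e ⊆ W \ A → e ⊆ U := fun e he hs =>
    h e he (Finset.disjoint_sdiff.mono_right hs)
  rw [← Finset.union_sdiff_of_subset hUW, indepDensity_union Finset.disjoint_sdiff,
    indepDensity_eq_one (W := (W \ A) \ U), mul_one]
  · intro e he hs
    obtain ⟨v, hv⟩ := hE e he
    exact (Finset.mem_sdiff.1 (hs hv)).2 (hsub e he (hs.trans Finset.sdiff_subset) hv)
  · intro e he hs
    exact Or.inl (hsub e he (by rwa [Finset.union_sdiff_of_subset hUW] at hs))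

theorem indepDensity_sdiff_div_le {E : Set (Finset ℕ)} {A W : Finset ℕ} (hA : A ⊆ W) :
    indepDensity E (W \ A) / 2 ^ A.card ≤ indepDensity E W := by
  rw [indepDensity, indepDensity, div_div, ← pow_add, Finset.card_sdiff_add_card_eq_card hA]
  gcongr
  intro I hI
  have hI := mem_indepSets.1 hI
  exact mem_indepSets.2 ⟨hI.1.trans Finset.sdiff_subset, hI.2⟩

theorem indepDensity_le_sdiff_add {E : Set (Finset ℕ)} {A W : Finset ℕ} (hA : A ⊆ W)
    {k : ℕ} {N : ℕ → Finset ℕ} (hN : ∀ a ∈ A, N a ⊆ W ∧ (N a).card = k ∧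
      ∀ v ∈ N a, {a, v} ∈ E) :
    indepDensity E W ≤ indepDensity E (W \ A) / 2 ^ A.card + A.card * (1 / 2) ^ k := by
  have hsub : indepSets E W ⊆ indepSets E (W \ A) ∪ A.biUnion fun a => (W \ N a).powerset := by
    intro I hI
    have hI := mem_indepSets.1 hI
    simp only [Finset.mem_union, mem_indepSets, Finset.mem_biUnion, Finset.mem_powerset,
      Finset.subset_sdiff]
    by_cases hd : Disjoint I A
    · exact Or.inl ⟨⟨hI.1, hd⟩, hI.2⟩
    · obtain ⟨a, haI, haA⟩ := Finset.not_disjoint_iff.1 hd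
      refine Or.inr ⟨a, haA, hI.1, Finset.disjoint_left.2 fun v hvI hv => ?_⟩
      refine hI.2 _ ((hN a haA).2.2 v hv) ?_
      simp [Finset.insert_subset_iff, haI, hvI]
  have hle : ((indepSets E W).card : ℝ) ≤
      (indepSets E (W \ A)).card + ∑ a ∈ A, ((W \ N a).powerset.card : ℝ) := by
    exact_mod_cast (Finset.card_le_card hsub).trans ((Finset.card_union_le _ _).trans
      (Nat.add_le_add_left Finset.card_biUnion_le _))
  have hterm : ∀ a ∈ A, ((W \ N a).powerset.card : ℝ) = 2 ^ W.card * (1 / 2) ^ k := by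
    intro a ha
    obtain ⟨hs, hc, -⟩ := hN a ha
    rw [Finset.card_powerset, ← Finset.card_sdiff_add_card_eq_card hs, hc, pow_add, mul_assoc,
      ← mul_pow]
    norm_num
  rw [Finset.sum_congr rfl hterm, Finset.sum_const, nsmul_eq_mul] at hle
  rw [indepDensity, indepDensity, div_div, ← pow_add, Finset.card_sdiff_add_card_eq_card hA,
    div_le_iff₀ (by positivity), add_mul, div_mul_cancel₀ _ (by positivity)]
  linarith

/-- If `G` is a countable graph (all hyperedges of size exactly `2`) with positive
independence density `x = id_{1/2}(G)`, then there is a finite graph with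
independence density exactly `x`. -/
theorem stmt_4 (G : HG) (hGval : G.Valid) (hGgraph : ∀ e ∈ G.edges, e.card = 2)
    (x : ℝ) (hx : G.idpLim (1 / 2) x) (hxpos : 0 < x) :
    ∃ H : FinHG, H.Valid ∧ (∀ e ∈ H.edges, e.card = 2) ∧ H.idp (1 / 2) = x := by
  classical
  obtain ⟨S, hS⟩ := HG.exists_finite_vertexCover hGval hGgraph hx hxpos
  obtain ⟨W, hW, hlim⟩ := hGval.exists_exhaustion hx
  set A := S.filter fun s => {e ∈ G.edges | s ∈ e}.Infinite
  have hAinf : ∀ a ∈ A, {e ∈ G.edges | a ∈ e}.Infinite := fun a ha => (Finset.mem_filter.1 ha).2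
  have hfin : {e ∈ G.edges | Disjoint A e}.Finite := by
    refine Set.Finite.subset ((S \ A).finite_toSet.biUnion
      (t := fun s => {e ∈ G.edges | s ∈ e}) fun s hs => ?_) ?_
    · have hs := Finset.mem_sdiff.1 (Finset.mem_coe.1 hs)
      by_contra hinf
      exact hs.2 (Finset.mem_filter.2 ⟨hs.1, hinf⟩)
    · rintro e ⟨he, hd⟩
      obtain ⟨s, hsS, hse⟩ := Finset.not_disjoint_iff.1 (hS e he)
      simp only [Set.mem_iUnion]
      exact ⟨s, Finset.mem_coe.2 (Finset.mem_sdiff.2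
        ⟨hsS, fun hsA => Finset.disjoint_left.1 hd hsA hse⟩), he, hse⟩
  set U := hfin.toFinset.biUnion id
  have hU : ∀ e ∈ G.edges, Disjoint A e → e ⊆ U := fun e he hd =>
    Finset.subset_biUnion_of_mem id (hfin.mem_toFinset.2 ⟨he, hd⟩)
  have hUv : (U : Set ℕ) ⊆ G.verts := by
    intro v hv
    obtain ⟨e, he, hve⟩ := Finset.mem_biUnion.1 (Finset.mem_coe.1 hv)
    exact (hGval e (hfin.mem_toFinset.1 he).1).2 hve
  have hAU : Disjoint A U := (Finset.disjoint_biUnion_right _ _ _).2 fun e he =>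
    (hfin.mem_toFinset.1 he).2
  have hAv : (A : Set ℕ) ⊆ G.verts := by
    intro a ha
    obtain ⟨e, he, hae⟩ := (hAinf a ha).nonempty
    exact (hGval e he).2 hae
  have hne : ∀ e ∈ G.edges, e.Nonempty := fun e he => (hGval e he).1
  have hxeq : x = indepDensity G.edges U / 2 ^ A.card := by
    apply le_antisymm
    · have hlim0 : Tendsto (fun k : ℕ => indepDensity G.edges U / 2 ^ A.card +
          A.card * (1 / 2 : ℝ) ^ k) atTop (𝓝 (indepDensity G.edges U / 2 ^ A.card)) := by
        simpa using ((tendsto_pow_atTop_nhds_zero_of_lt_one (by norm_num : (0 : ℝ) ≤ 1 / 2)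
          (by norm_num)).const_mul (A.card : ℝ)).const_add (indepDensity G.edges U / 2 ^ A.card)
      refine ge_of_tendsto' hlim0 fun k => ?_
      choose! N hNv hNc hNe using fun a (ha : a ∈ A) =>
        HG.exists_neighbors hGval hGgraph (hAinf a ha) k
      have hNW : ∀ᶠ n in atTop, A.biUnion N ⊆ W n := hW _ (by simpa using hNv)
      refine le_of_tendsto hlim ?_
      filter_upwards [hW A hAv, hW U hUv, hNW] with n hA hUn hNn
      rw [← indepDensity_sdiff hne hAU hUn hU]
      exact indepDensity_le_sdiff_add hA fun a ha =>
        ⟨(Finset.subset_biUnion_of_mem N ha).trans hNn, hNc a ha, hNe a ha⟩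
    · refine ge_of_tendsto hlim ?_
      filter_upwards [hW A hAv, hW U hUv] with n hA hUn
      rw [← indepDensity_sdiff hne hAU hUn hU]
      exact indepDensity_sdiff_div_le hA
  let H : FinHG := ⟨U, U.powerset.filter (· ∈ G.edges)⟩
  have hH : ∀ e ∈ H.edges, e ⊆ U ∧ e ∈ G.edges := fun e he =>
    ⟨Finset.mem_powerset.1 (Finset.mem_filter.1 he).1, (Finset.mem_filter.1 he).2⟩
  obtain ⟨K, hKv, hKg, hK⟩ := H.exists_idp_half_div_two_pow
    (fun e he => ⟨hne e (hH e he).2, (hH e he).1⟩) (fun e he => hGgraph e (hH e he).2) A.card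
  refine ⟨K, hKv, hKg, ?_⟩
  rw [hK, hxeq, FinHG.idp_half]
  congr 1
  exact indepDensity_congr fun e he => by simp [H, he]
end

section
/- Let H be a countable hypergraph and let {C_n}_{n≥1} and {G_n}_{n≥1} be two chains for H. Then for every p ∈ (0,1), the sequences {id_p(C_n)} and {id_p(G_n)} are non-increasing, their limits exist, and lim_{n→∞} id_p(C_n) = lim_{n→∞} id_p(G_n). -/
open Filter Topology

namespace FinHG

theorem idp_nonneg (F : FinHG) {p : ℝ} (hp0 : 0 ≤ p) (hp1 : p ≤ 1) : 0 ≤ F.idp p :=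
  Finset.sum_nonneg fun _ _ =>
    mul_nonneg (pow_nonneg hp0 _) (pow_nonneg (sub_nonneg.2 hp1) _)

/-- Splitting a subset of `F'.verts` into its parts inside and outside `F.verts` shows that the
density can only decrease when vertices and hyperedges are added. -/
theorem idp_le_idp {F F' : FinHG} (hV : F.verts ⊆ F'.verts) (hE : F.edges ⊆ F'.edges)
    {p : ℝ} (hp0 : 0 ≤ p) (hp1 : p ≤ 1) : F'.idp p ≤ F.idp p := by
  let split : Finset ℕ → Finset ℕ × Finset ℕ := fun I => (I ∩ F.verts, I \ F.verts)
  let w : Finset ℕ → Finset ℕ → ℝ := fun V I => p ^ I.card * (1 - p) ^ (V.card - I.card)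
  have hw : ∀ V I, 0 ≤ w V I := fun V I =>
    mul_nonneg (pow_nonneg hp0 _) (pow_nonneg (sub_nonneg.2 hp1) _)
  have split_inj : Function.Injective split := fun I J h => by
    obtain ⟨hinter, hsdiff⟩ := Prod.mk.inj h
    rw [← Finset.sdiff_union_inter I F.verts, ← Finset.sdiff_union_inter J F.verts,
      hinter, hsdiff]
  have weight_split : ∀ I ⊆ F'.verts,
      w F'.verts I = w F.verts (split I).1 * w (F'.verts \ F.verts) (split I).2 := by
    intro I hI
    have h1 := Finset.card_inter_add_card_sdiff I F.verts
    have h2 := Finset.card_sdiff_add_card_eq_card hV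
    have h3 : (I ∩ F.verts).card ≤ F.verts.card := Finset.card_le_card Finset.inter_subset_right
    have h4 : (I \ F.verts).card ≤ (F'.verts \ F.verts).card :=
      Finset.card_le_card (Finset.sdiff_subset_sdiff hI subset_rfl)
    have h5 : F'.verts.card - I.card = (F.verts.card - (I ∩ F.verts).card) +
        ((F'.verts \ F.verts).card - (I \ F.verts).card) := by omega
    simp only [w, split]
    rw [h5, ← h1, pow_add, pow_add]
    ring
  let A := F.verts.powerset.filter fun I => ∀ e ∈ F.edges, ¬ e ⊆ I
  let A' := F'.verts.powerset.filter fun I => ∀ e ∈ F'.edges, ¬ e ⊆ I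
  have split_mem : A'.image split ⊆ A ×ˢ (F'.verts \ F.verts).powerset := by
    intro x hx
    obtain ⟨I, hI, rfl⟩ := Finset.mem_image.1 hx
    obtain ⟨hIV, hIe⟩ := Finset.mem_filter.1 hI
    refine Finset.mem_product.2 ⟨Finset.mem_filter.2 ⟨?_, ?_⟩, ?_⟩
    · exact Finset.mem_powerset.2 Finset.inter_subset_right
    · exact fun e he h => hIe e (hE he) (h.trans Finset.inter_subset_left)
    · exact Finset.mem_powerset.2
        (Finset.sdiff_subset_sdiff (Finset.mem_powerset.1 hIV) subset_rfl)
  calc F'.idp p = ∑ I ∈ A', w F.verts (split I).1 * w (F'.verts \ F.verts) (split I).2 :=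
        Finset.sum_congr rfl fun I hI =>
          weight_split I (Finset.mem_powerset.1 (Finset.mem_filter.1 hI).1)
    _ = ∑ x ∈ A'.image split, w F.verts x.1 * w (F'.verts \ F.verts) x.2 :=
        (Finset.sum_image (f := fun x => w F.verts x.1 * w (F'.verts \ F.verts) x.2)
          split_inj.injOn).symm
    _ ≤ ∑ x ∈ A ×ˢ (F'.verts \ F.verts).powerset,
          w F.verts x.1 * w (F'.verts \ F.verts) x.2 :=
        Finset.sum_le_sum_of_subset_of_nonneg split_mem fun _ _ _ => mul_nonneg (hw _ _) (hw _ _)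
    _ = (∑ J ∈ A, w F.verts J) *
          ∑ K ∈ (F'.verts \ F.verts).powerset, w (F'.verts \ F.verts) K := by
        rw [Finset.sum_product, Finset.sum_mul_sum]
    _ = F.idp p := by
        simp only [w]
        rw [Finset.sum_pow_mul_eq_add_pow, add_sub_cancel, one_pow, mul_one]
        rfl

end FinHG

theorem Finset.eventually_subset_of_subset_iUnion {α : Type*} {S : ℕ → Finset α}
    (hS : Monotone S) {s : Finset α} (hs : (s : Set α) ⊆ ⋃ n, (S n : Set α)) :
    ∀ᶠ n in atTop, s ⊆ S n := by
  refine (Filter.eventually_all_finset s).2 fun a ha => ?_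
  obtain ⟨n, hn⟩ := Set.mem_iUnion.1 (hs ha)
  exact (eventually_ge_atTop n).mono fun m hm => hS hm hn

namespace HG.IsChain

variable {H : HG} {C G : ℕ → FinHG}

theorem monotone_verts (hC : H.IsChain C) : Monotone fun n => (C n).verts :=
  monotone_nat_of_le_succ hC.2.1

theorem monotone_edges (hC : H.IsChain C) : Monotone fun n => (C n).edges :=
  monotone_nat_of_le_succ fun n => (hC.2.2.1 n).le.trans (Finset.filter_subset _ _)

theorem antitone_idp (hC : H.IsChain C) {p : ℝ} (hp0 : 0 ≤ p) (hp1 : p ≤ 1) :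
    Antitone fun n => (C n).idp p := fun _ _ h =>
  FinHG.idp_le_idp (hC.monotone_verts h) (hC.monotone_edges h) hp0 hp1

theorem bddBelow_idp (C : ℕ → FinHG) {p : ℝ} (hp0 : 0 ≤ p) (hp1 : p ≤ 1) :
    BddBelow (Set.range fun n => (C n).idp p) :=
  ⟨0, Set.forall_mem_range.2 fun n => (C n).idp_nonneg hp0 hp1⟩

/-- Every member of one chain is eventually contained in the members of the other. -/
theorem iInf_idp_le (hC : H.IsChain C) (hG : H.IsChain G) {p : ℝ} (hp0 : 0 ≤ p) (hp1 : p ≤ 1) :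
    ⨅ n, (G n).idp p ≤ ⨅ n, (C n).idp p := by
  refine le_ciInf fun n => ?_
  have hverts : ((C n).verts : Set ℕ) ⊆ ⋃ m, ((G m).verts : Set ℕ) := by
    rw [hG.2.2.2.1, ← hC.2.2.2.1]
    exact Set.subset_iUnion (fun m => ((C m).verts : Set ℕ)) n
  have hedges : ((C n).edges : Set (Finset ℕ)) ⊆ ⋃ m, ((G m).edges : Set (Finset ℕ)) := by
    rw [hG.2.2.2.2, ← hC.2.2.2.2]
    exact Set.subset_iUnion (fun m => ((C m).edges : Set (Finset ℕ))) n
  obtain ⟨m, hmV, hmE⟩ :=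
    ((Finset.eventually_subset_of_subset_iUnion hG.monotone_verts hverts).and
      (Finset.eventually_subset_of_subset_iUnion hG.monotone_edges hedges)).exists
  exact (ciInf_le (bddBelow_idp G hp0 hp1) m).trans
    (FinHG.idp_le_idp hmV hmE hp0 hp1)

end HG.IsChain

/-- For any two chains for a countable hypergraph, the densities are non-increasing
and converge to the same limit. -/
theorem stmt_9 (H : HG) (hHval : H.Valid) (C G : ℕ → FinHG)
    (hC : H.IsChain C) (hG : H.IsChain G) (p : ℝ) (hp0 : 0 < p) (hp1 : p < 1) :
    Antitone (fun n => (C n).idp p) ∧ Antitone (fun n => (G n).idp p) ∧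
      ∃ x : ℝ, Tendsto (fun n => (C n).idp p) atTop (𝓝 x) ∧
        Tendsto (fun n => (G n).idp p) atTop (𝓝 x) := by
  have hanti := hC.antitone_idp hp0.le hp1.le
  have hanti' := hG.antitone_idp hp0.le hp1.le
  refine ⟨hanti, hanti', ⨅ n, (C n).idp p,
    tendsto_atTop_ciInf hanti (HG.IsChain.bddBelow_idp C hp0.le hp1.le), ?_⟩
  rw [(hG.iInf_idp_le hC hp0.le hp1.le).antisymm (hC.iInf_idp_le hG hp0.le hp1.le)]
  exact tendsto_atTop_ciInf hanti' (HG.IsChain.bddBelow_idp G hp0.le hp1.le)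
end
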